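/- Let n ≥ 1 and let W be an element of the n-qubit real Pauli group P_n that commutes with both I^{⊗(n−1)} ⊗ Z and I^{⊗(n−1)} ⊗ X (the matrices with Z, respectively X, in the last tensor factor and the 2×2 identity elsewhere). Then W = V ⊗ I for some element V of the (n−1)-qubit real Pauli group P_{n−1}. -/

import Mathlib

open Matrix

noncomputable section

namespace RealStab

abbrev Mat (n : ℕ) := Matrix (Fin n → Fin 2) (Fin n → Fin 2) ℝ

/-- The real Pauli matrix `X`. -/
def X2 : Matrix (Fin 2) (Fin 2) ℝ := !![0, 1; 1, 0]

/-- The real Pauli matrix `Z`. -/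
def Z2 : Matrix (Fin 2) (Fin 2) ℝ := !![1, 0; 0, -1]

/-- The set `{I, X, Z, XZ}` of single-qubit Pauli matrices. -/
def pauliSet : Set (Matrix (Fin 2) (Fin 2) ℝ) := {1, X2, Z2, X2 * Z2}

/-- The `n`-fold Kronecker (tensor) product `P 0 ⊗ ⋯ ⊗ P (n-1)`, represented as a
matrix indexed by functions `Fin n → Fin 2` (a `2^n × 2^n` matrix). -/
def tensorN {n : ℕ} (P : Fin n → Matrix (Fin 2) (Fin 2) ℝ) : Mat n :=
  Matrix.of fun x y => ∏ i, P i (x i) (y i)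

/-- The `n`-qubit real Pauli group `P_n`, as a set of `2^n × 2^n` real matrices. -/
def PauliGroup (n : ℕ) : Set (Mat n) :=
  { M | ∃ a : Fin 2, ∃ P : Fin n → Matrix (Fin 2) (Fin 2) ℝ,
      (∀ i, P i ∈ pauliSet) ∧ M = (-1 : ℝ) ^ (a : ℕ) • tensorN P }


/-- `I ⊗ ⋯ ⊗ I ⊗ X` (X on the last qubit). -/
def lastX (n : ℕ) : Mat n := tensorN (fun j => if (j : ℕ) = n - 1 then X2 else 1)

/-- `I ⊗ ⋯ ⊗ I ⊗ Z` (Z on the last qubit). -/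
def lastZ (n : ℕ) : Mat n := tensorN (fun j => if (j : ℕ) = n - 1 then Z2 else 1)

/-- The Kronecker product `V ⊗ S` of an `(n−1)`-qubit matrix `V` with a single-qubit
matrix `S`, as an `n`-qubit matrix (for `n ≥ 1`). -/
def kronLast {n : ℕ} (hn : 1 ≤ n) (V : Mat (n - 1)) (S : Matrix (Fin 2) (Fin 2) ℝ) :
    Mat n :=
  Matrix.of fun x y =>
    V (fun i => x (Fin.castLE (Nat.sub_le n 1) i)) (fun i => y (Fin.castLE (Nat.sub_le n 1) i)) *
      S (x ⟨n - 1, by omega⟩) (y ⟨n - 1, by omega⟩)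

theorem tensorN_mul {n : ℕ} (P Q : Fin n → Matrix (Fin 2) (Fin 2) ℝ) :
    tensorN P * tensorN Q = tensorN (P * Q) := by
  ext x y
  simp only [tensorN, Matrix.mul_apply, Matrix.of_apply, Pi.mul_apply, Finset.prod_univ_sum,
    Fintype.piFinset_univ, Finset.prod_mul_distrib]

/-- If two tensor products agree, and their factors away from position `i` agree and are nonzero,
then the factors at position `i` agree. -/
theorem eq_of_tensorN_eq {n : ℕ} {A B : Fin n → Matrix (Fin 2) (Fin 2) ℝ} (i : Fin n)
    (hne : ∀ j ≠ i, A j ≠ 0) (hAB : ∀ j ≠ i, A j = B j) (h : tensorN A = tensorN B) :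
    A i = B i := by
  have hentry : ∀ j, ∃ x y, j ≠ i → A j x y ≠ 0 := by
    intro j
    by_contra! hj
    exact hne j (hj 0 0).1 (Matrix.ext fun x y => (hj x y).2)
  choose f g hfg using hentry
  ext a b
  have hab := congrFun (congrFun h (Function.update f i a)) (Function.update g i b)
  simp only [tensorN, Matrix.of_apply] at hab
  rw [← Finset.mul_prod_erase _ _ (Finset.mem_univ i),
    ← Finset.mul_prod_erase _ _ (Finset.mem_univ i)] at hab
  have hprod : ∏ j ∈ Finset.univ.erase i,
        B j (Function.update f i a j) (Function.update g i b j) =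
      ∏ j ∈ Finset.univ.erase i, A j (Function.update f i a j) (Function.update g i b j) :=
    Finset.prod_congr rfl fun j hj => by rw [hAB j (Finset.ne_of_mem_erase hj)]
  rw [hprod] at hab
  have hnz : ∏ j ∈ Finset.univ.erase i,
      A j (Function.update f i a j) (Function.update g i b j) ≠ 0 :=
    Finset.prod_ne_zero_iff.mpr fun j hj => by
      have hji := Finset.ne_of_mem_erase hj
      simpa [hji] using hfg j hji
  simpa using mul_right_cancel₀ hnz hab

theorem ne_zero_of_mem_pauliSet {M : Matrix (Fin 2) (Fin 2) ℝ} (hM : M ∈ pauliSet) : M ≠ 0 := by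
  rcases hM with rfl | rfl | rfl | rfl <;> intro h <;>
    have h0 := congrFun (congrFun h 0) 0 <;> have h1 := congrFun (congrFun h 0) 1 <;>
    simp [X2, Z2] at h0 h1

theorem eq_one_of_mem_pauliSet_of_commute {M : Matrix (Fin 2) (Fin 2) ℝ} (hM : M ∈ pauliSet)
    (hZ : M * Z2 = Z2 * M) (hX : M * X2 = X2 * M) : M = 1 := by
  rcases hM with rfl | rfl | rfl | rfl
  · rfl
  · have h := congrFun (congrFun hZ 0) 1
    norm_num [X2, Z2] at h
  · have h := congrFun (congrFun hX 0) 1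
    norm_num [X2, Z2] at h
  · have h := congrFun (congrFun hX 0) 0
    norm_num [X2, Z2] at h

/-- If a nonzero multiple of the Pauli string `P` commutes with a tensor product `Q` that is the identity
away from position `i`, then the factors of `P` and `Q` at position `i` commute. -/
theorem factor_commute_of_commute {n : ℕ} {c : ℝ} (hc : c ≠ 0)
    {P Q : Fin n → Matrix (Fin 2) (Fin 2) ℝ} (hP : ∀ i, P i ∈ pauliSet) (i : Fin n)
    (hQ : ∀ j ≠ i, Q j = 1) (h : (c • tensorN P) * tensorN Q = tensorN Q * (c • tensorN P)) :
    P i * Q i = Q i * P i := by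
  rw [smul_mul_assoc, mul_smul_comm, tensorN_mul, tensorN_mul] at h
  refine eq_of_tensorN_eq (A := P * Q) (B := Q * P) i ?_ ?_ (smul_right_injective _ hc h)
  · intro j hj
    simpa [hQ j hj] using ne_zero_of_mem_pauliSet (hP j)
  · intro j hj
    simp [hQ j hj]

/-- For `n ≥ 1`, if `W ∈ P_n` commutes with both `I^{⊗(n−1)} ⊗ Z`
and `I^{⊗(n−1)} ⊗ X`, then `W = V ⊗ I` for some `V ∈ P_{n−1}`. -/
theorem pauli_commuting_factors (n : ℕ) (hn : 1 ≤ n) (W : Mat n)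
    (hW : W ∈ PauliGroup n)
    (hZ : W * lastZ n = lastZ n * W) (hX : W * lastX n = lastX n * W) :
    ∃ V ∈ PauliGroup (n - 1), W = kronLast hn V 1 := by
  obtain ⟨m, rfl⟩ : ∃ m, n = m + 1 := ⟨n - 1, by omega⟩
  obtain ⟨a, P, hP, rfl⟩ := hW
  have hc : (-1 : ℝ) ^ (a : ℕ) ≠ 0 := pow_ne_zero _ (by norm_num)
  have hoff : ∀ S : Matrix (Fin 2) (Fin 2) ℝ, ∀ j ≠ Fin.last m,
      (if (j : ℕ) = m + 1 - 1 then S else 1) = 1 := fun S j hj =>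
    if_neg fun h => hj (Fin.ext h)
  have hlast : P (Fin.last m) = 1 := by
    refine eq_one_of_mem_pauliSet_of_commute (hP _) ?_ ?_
    · simpa using factor_commute_of_commute hc hP (Fin.last m) (hoff Z2) hZ
    · simpa using factor_commute_of_commute hc hP (Fin.last m) (hoff X2) hX
  refine ⟨(-1 : ℝ) ^ (a : ℕ) • tensorN fun i : Fin m => P i.castSucc,
    ⟨a, _, fun i => hP _, rfl⟩, ?_⟩
  ext x y
  change (-1 : ℝ) ^ (a : ℕ) * ∏ i, P i (x i) (y i) =
    ((-1 : ℝ) ^ (a : ℕ) * ∏ i : Fin m, P i.castSucc (x i.castSucc) (y i.castSucc)) *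
      (1 : Matrix (Fin 2) (Fin 2) ℝ) (x (Fin.last m)) (y (Fin.last m))
  rw [Fin.prod_univ_castSucc, hlast, mul_assoc]

end RealStab

end
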